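/- The system dW/dx = ρA(x)W has a strong regular fundamental solution at x₀ for every ρ ∈ ℂ if and only if α₀ = β₀ and γ₋₁ = 0. -/

import Mathlib

open Filter Topology

section PowerSeries

variable {E : Type*} [NormedAddCommGroup E]

/-- Cauchy bounds on all smaller circles give absolute summability on all smaller circles. -/
lemma summable_norm_mul_pow_of_bounded {c : ℕ → E} {R : ℝ}
    (hc : ∀ r, 0 < r → r < R → ∃ C, ∀ n, ‖c n‖ * r ^ n ≤ C) {r : ℝ} (hr : 0 ≤ r) (hrR : r < R) :
    Summable (fun n => ‖c n‖ * r ^ n) := by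
  obtain ⟨s, hrs, hsR⟩ := exists_between hrR
  have hs : 0 < s := hr.trans_lt hrs
  obtain ⟨C, hC⟩ := hc s hs hsR
  have hq : Summable (fun n : ℕ => C * (r / s) ^ n) :=
    (summable_geometric_of_lt_one (by positivity) ((div_lt_one hs).2 hrs)).mul_left C
  refine Summable.of_nonneg_of_le (fun n => by positivity) (fun n => ?_) hq
  calc ‖c n‖ * r ^ n = (‖c n‖ * s ^ n) * (r / s) ^ n := by
        rw [div_pow]; field_simp
    _ ≤ C * (r / s) ^ n := by gcongr; exact hC n

variable [NormedSpace ℂ E]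

lemma bounded_of_summable {c : ℕ → E} {R : ℝ}
    (hc : ∀ r : ℝ, 0 < r → r < R → Summable (fun n => (r : ℂ) ^ n • c n)) {r : ℝ} (hr : 0 < r)
    (hrR : r < R) : ∃ C, ∀ n, ‖c n‖ * r ^ n ≤ C := by
  obtain ⟨C, hC⟩ := ((hc r hr hrR).tendsto_atTop_zero.norm).bddAbove_range
  refine ⟨C, fun n => ?_⟩
  have := hC ⟨n, rfl⟩
  simpa [norm_smul, abs_of_pos hr, mul_comm] using this

lemma summable_pow_smul_of_bounded [CompleteSpace E] {c : ℕ → E} {R : ℝ}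
    (hc : ∀ r, 0 < r → r < R → ∃ C, ∀ n, ‖c n‖ * r ^ n ≤ C) {t : ℂ} (ht : ‖t‖ < R) :
    Summable (fun n => t ^ n • c n) := by
  refine Summable.of_norm ?_
  simpa [norm_smul, mul_comm] using summable_norm_mul_pow_of_bounded hc (norm_nonneg t) ht

/-- Termwise differentiation of a power series. -/
lemma hasDerivAt_tsum_pow_smul [CompleteSpace E] {c : ℕ → E} {R : ℝ}
    (hc : ∀ r, 0 < r → r < R → ∃ C, ∀ n, ‖c n‖ * r ^ n ≤ C) {x₀ x : ℂ} (hx : ‖x - x₀‖ < R) :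
    HasDerivAt (fun y => ∑' n, (y - x₀) ^ n • c n)
      (∑' n : ℕ, (x - x₀) ^ n • (((n : ℂ) + 1) • c (n + 1))) x := by
  obtain ⟨r, hxr, hrR⟩ := exists_between hx
  obtain ⟨s, hrs, hsR⟩ := exists_between hrR
  have hr : 0 < r := (norm_nonneg _).trans_lt hxr
  have hs : 0 < s := hr.trans hrs
  obtain ⟨C, hC⟩ := hc s hs hsR
  have hu : Summable (fun n : ℕ => C / r * ((n : ℝ) ^ 1 * (r / s) ^ n)) := by
    have hq : ‖r / s‖ < 1 := by
      rw [Real.norm_of_nonneg (by positivity)]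
      exact (div_lt_one hs).2 hrs
    exact (summable_pow_mul_geometric_of_norm_lt_one 1 hq).mul_left (C / r)
  have hbd : ∀ (n : ℕ), ∀ y ∈ Metric.ball x₀ r,
      ‖((n : ℂ) * (y - x₀) ^ (n - 1)) • c n‖ ≤ C / r * ((n : ℝ) ^ 1 * (r / s) ^ n) := by
    intro n y hy
    rw [Metric.mem_ball, dist_eq_norm] at hy
    rcases n with _ | n
    · simp
    · have h1 : ‖y - x₀‖ ^ n ≤ r ^ n := pow_le_pow_left₀ (norm_nonneg _) hy.le n
      have h2 := hC (n + 1)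
      rw [norm_smul, norm_mul, norm_pow, Complex.norm_natCast, Nat.add_sub_cancel]
      calc ((n + 1 : ℕ) : ℝ) * ‖y - x₀‖ ^ n * ‖c (n + 1)‖
          ≤ ((n + 1 : ℕ) : ℝ) * r ^ n * ‖c (n + 1)‖ := by gcongr
        _ = (‖c (n + 1)‖ * s ^ (n + 1)) * (((n + 1 : ℕ) : ℝ) / r * (r / s) ^ (n + 1)) := by
            rw [div_pow]; field_simp; ring
        _ ≤ C * (((n + 1 : ℕ) : ℝ) / r * (r / s) ^ (n + 1)) := by gcongr
        _ = _ := by ring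
  have hxm : x ∈ Metric.ball x₀ r := by rwa [Metric.mem_ball, dist_eq_norm]
  have key := hasDerivAt_tsum_of_isPreconnected (g := fun n y => (y - x₀) ^ n • c n)
    (g' := fun (n : ℕ) y => ((n : ℂ) * (y - x₀) ^ (n - 1)) • c n) hu Metric.isOpen_ball
    (convex_ball x₀ r).isPreconnected (fun n y _ => ?_) hbd hxm
    (summable_pow_smul_of_bounded hc hx) hxm
  · refine key.congr_deriv ?_
    have hs' : Summable (fun n : ℕ => ((n : ℂ) * (x - x₀) ^ (n - 1)) • c n) :=
      Summable.of_norm_bounded hu (fun n => hbd n x hxm)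
    rw [hs'.tsum_eq_zero_add]
    simp [smul_smul, mul_comm]
  · have := (((hasDerivAt_id y).sub_const x₀).pow n).smul_const (c n)
    simpa using this

/-- The sum of a scalar power series converging on a punctured disc is holomorphic on the disc. -/
lemma exists_holomorphic_of_hasSum {x₀ : ℂ} {R : ℝ} {c : ℕ → ℂ} {a : ℂ → ℂ}
    (h : ∀ x, 0 < ‖x - x₀‖ → ‖x - x₀‖ < R → HasSum (fun k : ℕ => c k * (x - x₀) ^ k) (a x)) :
    ∃ f : ℂ → ℂ, DifferentiableOn ℂ f (Metric.ball x₀ R) ∧ f x₀ = c 0 ∧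
      ∀ x, 0 < ‖x - x₀‖ → ‖x - x₀‖ < R → a x = f x := by
  have hc : ∀ r, 0 < r → r < R → ∃ C, ∀ n, ‖c n‖ * r ^ n ≤ C := by
    intro r hr hrR
    refine bounded_of_summable (R := R) (fun s hs hsR => ?_) hr hrR
    have := (h (x₀ + s) (by simpa using hs.ne') (by simpa [abs_of_pos hs] using hsR)).summable
    simpa [mul_comm] using this
  refine ⟨fun y => ∑' n, (y - x₀) ^ n • c n, fun x hx => ?_, ?_, fun x h0 h1 => ?_⟩
  · rw [Metric.mem_ball, dist_eq_norm] at hx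
    exact (hasDerivAt_tsum_pow_smul hc hx).differentiableAt.differentiableWithinAt
  · simp only [sub_self]
    rw [tsum_eq_single 0 (by intro n hn; simp [hn])]
    simp
  · rw [← (h x h0 h1).tsum_eq]
    simp [mul_comm]

end PowerSeries

section LinearODE

variable {R : Type*} [NormedRing R] [NormedAlgebra ℂ R]

/-- Taylor coefficients of the solution of `Z' = B Z`, `Z(x₀) = 1`, in terms of those of `B`. -/
noncomputable def linearODECoeff (b : ℕ → R) : ℕ → R
  | 0 => 1
  | n + 1 => ((n : ℂ) + 1)⁻¹ • ∑ i : Fin (n + 1), b (n - i) * linearODECoeff b i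

lemma linearODECoeff_succ (b : ℕ → R) (n : ℕ) :
    ((n : ℂ) + 1) • linearODECoeff b (n + 1) =
      ∑ kl ∈ Finset.HasAntidiagonal.antidiagonal n, b kl.1 * linearODECoeff b kl.2 := by
  rw [linearODECoeff, smul_smul, mul_inv_cancel₀ (Nat.cast_add_one_ne_zero n), one_smul,
    ← Finset.sum_range (fun i => b (n - i) * linearODECoeff b i), ← Finset.sum_flip,
    Finset.Nat.sum_antidiagonal_eq_sum_range_succ (fun i j => b i * linearODECoeff b j)]
  refine Finset.sum_congr rfl fun i hi => ?_
  rw [Nat.sub_sub_self (Nat.le_of_lt_succ (Finset.mem_range.1 hi))]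

lemma linearODECoeff_bounded {b : ℕ → R} {r : ℝ} (hr : 0 < r)
    (hb : Summable (fun n => ‖b n‖ * r ^ n)) :
    ∃ C, ∀ n, ‖linearODECoeff b n‖ * r ^ n ≤ C := by
  set z : ℕ → ℝ := fun n => ‖linearODECoeff b n‖ * r ^ n with hz
  have hz0 : ∀ n, 0 ≤ z n := fun n => by positivity
  set S := ∑' n, ‖b n‖ * r ^ n
  obtain ⟨N, hN⟩ := exists_nat_ge (r * S)
  set C := ∑ j ∈ Finset.range (N + 1), z j
  have hC0 : 0 ≤ C := Finset.sum_nonneg fun j _ => hz0 j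
  refine ⟨C, fun n => ?_⟩
  change z n ≤ C
  induction n using Nat.strong_induction_on with
  | _ n ih =>
    rcases le_or_gt n N with hn | hn
    · exact Finset.single_le_sum (fun j _ => hz0 j) (Finset.mem_range.2 (by omega))
    · obtain ⟨m, rfl⟩ : ∃ m, n = m + 1 := ⟨n - 1, by omega⟩
      have h1 : ((m : ℝ) + 1) * z (m + 1) ≤ r * (S * C) := by
        have h2 : ((m : ℝ) + 1) * ‖linearODECoeff b (m + 1)‖ =
            ‖∑ kl ∈ Finset.HasAntidiagonal.antidiagonal m, b kl.1 * linearODECoeff b kl.2‖ := by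
          rw [← linearODECoeff_succ, norm_smul]
          congr 1
          exact_mod_cast (Complex.norm_natCast (m + 1)).symm
        calc ((m : ℝ) + 1) * z (m + 1)
            = (((m : ℝ) + 1) * ‖linearODECoeff b (m + 1)‖) * r ^ (m + 1) := by
              simp only [hz]; ring
          _ ≤ (∑ kl ∈ Finset.HasAntidiagonal.antidiagonal m, ‖b kl.1‖ * ‖linearODECoeff b kl.2‖) *
                r ^ (m + 1) := by
              rw [h2]
              gcongr
              exact (norm_sum_le _ _).trans (Finset.sum_le_sum fun _ _ => norm_mul_le _ _)
          _ = r * ∑ kl ∈ Finset.HasAntidiagonal.antidiagonal m, (‖b kl.1‖ * r ^ kl.1) * z kl.2 := by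
              rw [Finset.sum_mul, Finset.mul_sum]
              refine Finset.sum_congr rfl fun kl hkl => ?_
              rw [Finset.HasAntidiagonal.mem_antidiagonal] at hkl
              rw [← hkl]
              simp only [hz]
              ring
          _ ≤ r * ∑ kl ∈ Finset.HasAntidiagonal.antidiagonal m, (‖b kl.1‖ * r ^ kl.1) * C := by
              gcongr with kl hkl
              rw [Finset.HasAntidiagonal.mem_antidiagonal] at hkl
              exact ih kl.2 (by omega)
          _ ≤ r * (S * C) := by
              rw [← Finset.sum_mul, Finset.Nat.sum_antidiagonal_eq_sum_range_succ_mk]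
              gcongr
              exact hb.sum_le_tsum _ (fun _ _ => by positivity)
      have h3 : r * S ≤ (m : ℝ) + 1 := hN.trans (by exact_mod_cast hn.le)
      have h4 : ((m : ℝ) + 1) * z (m + 1) ≤ ((m : ℝ) + 1) * C :=
        h1.trans (by rw [← mul_assoc]; gcongr)
      exact le_of_mul_le_mul_left h4 (by positivity)

/-- A linear ODE with holomorphic coefficient on a disc has a holomorphic solution there, with
value `1` at the centre. -/
lemma exists_linearODE_solution [CompleteSpace R] {x₀ : ℂ} {ρ : ℝ} {B : ℂ → R}
    (hB : DifferentiableOn ℂ B (Metric.ball x₀ ρ)) :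
    ∃ Z : ℂ → R, Z x₀ = 1 ∧ ∀ x ∈ Metric.ball x₀ ρ, HasDerivAt Z (B x * Z x) x := by
  set b : ℕ → R := fun n => (n.factorial : ℂ)⁻¹ • iteratedDeriv n B x₀ with hb
  have hsum : ∀ x ∈ Metric.ball x₀ ρ, HasSum (fun n => (x - x₀) ^ n • b n) (B x) := by
    intro x hx
    have h := Complex.hasSum_taylorSeries_on_ball hB hx
    have he : ∀ n : ℕ, (x - x₀) ^ n • b n =
        (n.factorial : ℂ)⁻¹ • (x - x₀) ^ n • iteratedDeriv n B x₀ := fun n => smul_comm _ _ _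
    exact (funext he) ▸ h
  have hbb : ∀ r, 0 < r → r < ρ → ∃ C, ∀ n, ‖b n‖ * r ^ n ≤ C := by
    intro r hr hrR
    refine bounded_of_summable (R := ρ) (fun s hs hsR => ?_) hr hrR
    simpa using (hsum (x₀ + s) (by simpa [abs_of_pos hs] using hsR)).summable
  have hzb : ∀ r, 0 < r → r < ρ → ∃ C, ∀ n, ‖linearODECoeff b n‖ * r ^ n ≤ C := fun r hr hrR =>
    linearODECoeff_bounded hr (summable_norm_mul_pow_of_bounded hbb hr.le hrR)
  refine ⟨fun y => ∑' n, (y - x₀) ^ n • linearODECoeff b n, ?_, fun x hx => ?_⟩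
  · simp only [sub_self]
    rw [tsum_eq_single 0 (by intro n hn; simp [hn])]
    simp [linearODECoeff]
  · have hx' : ‖x - x₀‖ < ρ := by rwa [Metric.mem_ball, dist_eq_norm] at hx
    refine (hasDerivAt_tsum_pow_smul hzb hx').congr_deriv ?_
    symm
    rw [← (hsum x hx).tsum_eq, tsum_mul_tsum_eq_tsum_sum_antidiagonal_of_summable_norm]
    · refine tsum_congr fun n => ?_
      rw [linearODECoeff_succ, Finset.smul_sum]
      refine Finset.sum_congr rfl fun kl hkl => ?_
      rw [Finset.HasAntidiagonal.mem_antidiagonal] at hkl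
      rw [smul_mul_smul_comm, ← pow_add, hkl]
    · simpa [norm_smul, mul_comm] using
        summable_norm_mul_pow_of_bounded hbb (norm_nonneg (x - x₀)) hx'
    · simpa [norm_smul, mul_comm] using
        summable_norm_mul_pow_of_bounded hzb (norm_nonneg (x - x₀)) hx'

/-- A solution of a scalar linear ODE that does not vanish at the centre of a disc vanishes
nowhere on the disc. -/
lemma ne_zero_of_scalar_linearODE {x₀ : ℂ} {ρ : ℝ} {τ f : ℂ → ℂ}
    (hτ : DifferentiableOn ℂ τ (Metric.ball x₀ ρ))
    (hf : ∀ x ∈ Metric.ball x₀ ρ, HasDerivAt f (τ x * f x) x) (h0 : f x₀ ≠ 0) :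
    ∀ x ∈ Metric.ball x₀ ρ, f x ≠ 0 := by
  obtain ⟨g, hg1, hg⟩ := exists_linearODE_solution (B := fun x => -τ x) hτ.neg
  intro x hx hfx
  have hd : ∀ y ∈ Metric.ball x₀ ρ, HasDerivAt (fun y => f y * g y) 0 y := by
    intro y hy
    refine ((hf y hy).mul (hg y hy)).congr_deriv ?_
    ring
  have hx0 : x₀ ∈ Metric.ball x₀ ρ :=
    Metric.mem_ball_self (dist_nonneg.trans_lt (Metric.mem_ball.1 hx))
  have := Metric.isOpen_ball.is_const_of_deriv_eq_zero (convex_ball x₀ ρ).isPreconnected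
    (fun y hy => (hd y hy).differentiableAt.differentiableWithinAt)
    (fun y hy => (hd y hy).deriv) hx hx0
  simp only [hfx, hg1, zero_mul, mul_one] at this
  exact h0 this.symm

open scoped Matrix.Norms.Operator in
/-- Fundamental solutions of holomorphic linear systems on a disc. -/
lemma exists_fundamental_solution {x₀ : ℂ} {ρ : ℝ}
    {B : ℂ → Matrix (Fin 2) (Fin 2) ℂ}
    (hB : ∀ i j, DifferentiableOn ℂ (fun x => B x i j) (Metric.ball x₀ ρ)) :
    ∃ Z : ℂ → Matrix (Fin 2) (Fin 2) ℂ,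
      (∀ x ∈ Metric.ball x₀ ρ, ∀ i j, HasDerivAt (fun y => Z y i j) ((B x * Z x) i j) x) ∧
      ∀ x ∈ Metric.ball x₀ ρ, (Z x).det ≠ 0 := by
  have hB' : DifferentiableOn ℂ B (Metric.ball x₀ ρ) := by
    have : B = fun x => ∑ i, ∑ j, B x i j • Matrix.single i j (1 : ℂ) := by
      ext1 x
      conv_lhs => rw [Matrix.matrix_eq_sum_single (B x)]
      simp [Matrix.smul_single]
    rw [this]
    exact DifferentiableOn.fun_sum fun i _ => DifferentiableOn.fun_sum fun j _ =>
      (hB i j).smul_const _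
  obtain ⟨Z, hZ1, hZ⟩ := exists_linearODE_solution hB'
  have hent : ∀ x ∈ Metric.ball x₀ ρ, ∀ i j,
      HasDerivAt (fun y => Z y i j) ((B x * Z x) i j) x := by
    intro x hx i j
    exact ((Matrix.entryLinearMap ℂ ℂ i j).toContinuousLinearMap.hasFDerivAt.comp_hasDerivAt x
      (hZ x hx))
  refine ⟨Z, hent, ?_⟩
  refine ne_zero_of_scalar_linearODE (τ := fun x => B x 0 0 + B x 1 1)
    ((hB 0 0).add (hB 1 1)) (fun x hx => ?_) (by simp [hZ1])
  simp only [Matrix.det_fin_two]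
  refine (((hent x hx 0 0).mul (hent x hx 1 1)).sub
    ((hent x hx 0 1).mul (hent x hx 1 0))).congr_deriv ?_
  simp only [Matrix.mul_apply, Fin.sum_univ_two]
  ring

end LinearODE

section RegularSingular

/-- The indicial equation at a simple pole: if `f = (x - x₀) ^ p * u` with `u` analytic and
`(x - x₀) * f' = (x - x₀) ^ p * r` with `r` continuous, then `p * u x₀ = r x₀`. -/
lemma indicial_equation {x₀ : ℂ} {p : ℤ} {u f r : ℂ → ℂ} (hu : AnalyticAt ℂ u x₀)
    (hr : ContinuousAt r x₀) (hf : ∀ᶠ x in 𝓝[≠] x₀, f x = (x - x₀) ^ p * u x)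
    (hd : ∀ᶠ x in 𝓝[≠] x₀, HasDerivAt f ((x - x₀) ^ (p - 1) * r x) x) :
    (p : ℂ) * u x₀ = r x₀ := by
  have hu' : ∀ᶠ x in 𝓝[≠] x₀, AnalyticAt ℂ u x := hu.eventually_analyticAt.filter_mono
    nhdsWithin_le_nhds
  have heq : ∀ᶠ x in 𝓝[≠] x₀, (p : ℂ) * u x + (x - x₀) * deriv u x = r x := by
    filter_upwards [eventually_eventually_nhdsWithin.2 hf, hd, hu', self_mem_nhdsWithin]
      with x hfx hdx hux hx
    rw [isOpen_compl_singleton.nhdsWithin_eq hx] at hfx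
    have hx0 : x - x₀ ≠ 0 := sub_ne_zero.2 hx
    have h1 : HasDerivAt (fun y => (y - x₀) ^ p) (p * (x - x₀) ^ (p - 1)) x :=
      (hasDerivAt_zpow p (x - x₀) (Or.inl hx0)).comp_sub_const x x₀
    have h2 := (h1.mul hux.differentiableAt.hasDerivAt).congr_of_eventuallyEq hfx
    have h3 := h2.unique hdx
    have h4 : (x - x₀) ^ p = (x - x₀) ^ (p - 1) * (x - x₀) := by
      rw [← zpow_add_one₀ hx0]; simp
    rw [h4] at h3
    refine mul_left_cancel₀ (zpow_ne_zero (p - 1) hx0) ?_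
    rw [← h3]
    ring
  have hc : ContinuousAt (fun x => (p : ℂ) * u x + (x - x₀) * deriv u x) x₀ :=
    (continuousAt_const.mul hu.continuousAt).add
      ((continuousAt_id.sub continuousAt_const).mul hu.deriv.continuousAt)
  have hl := hc.tendsto.mono_left (nhdsWithin_le_nhds (s := {x₀}ᶜ))
  have := tendsto_nhds_unique (hl.congr' heq) (hr.tendsto.mono_left nhdsWithin_le_nhds)
  simpa using this

/-- A system `Z' = (B + κ / (x - x₀) * E₁₂) Z` with `B` continuous at `x₀` has a meromorphic
fundamental solution only if `κ = 0`. -/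
lemma residue_eq_zero_of_meromorphic_fundamental {x₀ κ : ℂ} {k : ℤ}
    {B Z V : ℂ → Matrix (Fin 2) (Fin 2) ℂ}
    (hB : ∀ i j, ContinuousAt (fun x => B x i j) x₀)
    (hV : ∀ i j, AnalyticAt ℂ (fun x => V x i j) x₀)
    (hZV : ∀ᶠ x in 𝓝[≠] x₀, Z x = (x - x₀) ^ k • V x)
    (hdet : ∀ᶠ x in 𝓝[≠] x₀, (Z x).det ≠ 0)
    (h0 : ∀ᶠ x in 𝓝[≠] x₀, ∀ j, HasDerivAt (fun y => Z y 0 j)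
      (B x 0 0 * Z x 0 j + (B x 0 1 + κ / (x - x₀)) * Z x 1 j) x)
    (h1 : ∀ᶠ x in 𝓝[≠] x₀, ∀ j, HasDerivAt (fun y => Z y 1 j)
      (B x 1 0 * Z x 0 j + B x 1 1 * Z x 1 j) x) :
    κ = 0 := by
  have hv : AnalyticAt ℂ (fun x i j => V x i j) x₀ :=
    analyticAt_pi_iff.2 fun i => analyticAt_pi_iff.2 fun j => hV i j
  have hne : ¬ ∀ᶠ x in 𝓝 x₀, (fun x i j => V x i j) x = 0 := by
    intro h
    obtain ⟨x, hx1, hx2, hx3⟩ := ((h.filter_mono (nhdsWithin_le_nhds (s := {x₀}ᶜ))).and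
      (hZV.and hdet)).exists
    have hVx : V x = 0 := hx1
    exact hx3 (by rw [hx2, hVx]; simp)
  obtain ⟨n, g, hg, hg0, hVg⟩ := hv.exists_eventuallyEq_pow_smul_nonzero_iff.2 hne
  have hgij : ∀ i j, AnalyticAt ℂ (fun x => g x i j) x₀ := fun i j =>
    analyticAt_pi_iff.1 (analyticAt_pi_iff.1 hg i) j
  set p : ℤ := k + n with hp
  have hZg : ∀ᶠ x in 𝓝[≠] x₀, ∀ i j, Z x i j = (x - x₀) ^ p * g x i j := by
    filter_upwards [hZV, hVg.filter_mono nhdsWithin_le_nhds, self_mem_nhdsWithin]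
      with x hx1 hx2 hx3 i j
    have h := congrFun (congrFun hx2 i) j
    simp only [Pi.smul_apply, smul_eq_mul] at h
    rw [hx1, Matrix.smul_apply, h, hp, zpow_add₀ (sub_ne_zero.2 hx3), zpow_natCast, smul_eq_mul,
      mul_assoc]
  have hsub : ContinuousAt (fun x => x - x₀) x₀ := by fun_prop
  have hgc : ∀ i j, ContinuousAt (fun x => g x i j) x₀ := fun i j => (hgij i j).continuousAt
  have e0 : ∀ j, (p : ℂ) * g x₀ 0 j = κ * g x₀ 1 j := by
    intro j
    have := indicial_equation (p := p) (u := fun x => g x 0 j) (f := fun x => Z x 0 j)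
      (r := fun x => (x - x₀) * (B x 0 0 * g x 0 j + B x 0 1 * g x 1 j) + κ * g x 1 j)
      (hgij 0 j)
      ((hsub.mul (((hB 0 0).mul (hgc 0 j)).add ((hB 0 1).mul (hgc 1 j)))).add
        (continuousAt_const.mul (hgc 1 j)))
      (hZg.mono fun x hx => hx 0 j) (by
        filter_upwards [hZg, h0, self_mem_nhdsWithin] with x hx1 hx2 hx3
        have hx0 : x - x₀ ≠ 0 := sub_ne_zero.2 hx3
        refine (hx2 j).congr_deriv ?_
        rw [hx1, hx1, zpow_sub_one₀ hx0]
        field_simp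
        ring)
    simpa using this
  have e1 : ∀ j, (p : ℂ) * g x₀ 1 j = 0 := by
    intro j
    have := indicial_equation (p := p) (u := fun x => g x 1 j) (f := fun x => Z x 1 j)
      (r := fun x => (x - x₀) * (B x 1 0 * g x 0 j + B x 1 1 * g x 1 j))
      (hgij 1 j)
      (hsub.mul (((hB 1 0).mul (hgc 0 j)).add ((hB 1 1).mul (hgc 1 j))))
      (hZg.mono fun x hx => hx 1 j) (by
        filter_upwards [hZg, h1, self_mem_nhdsWithin] with x hx1 hx2 hx3
        have hx0 : x - x₀ ≠ 0 := sub_ne_zero.2 hx3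
        refine (hx2 j).congr_deriv ?_
        rw [hx1, hx1, zpow_sub_one₀ hx0]
        field_simp)
    simpa using this
  by_contra hκ
  have hp0 : p = 0 := by
    by_contra hp0
    have hpc : (p : ℂ) ≠ 0 := Int.cast_ne_zero.2 hp0
    have e1' : ∀ j, g x₀ 1 j = 0 := fun j => (mul_eq_zero.1 (e1 j)).resolve_left hpc
    have e0' : ∀ j, g x₀ 0 j = 0 := fun j =>
      (mul_eq_zero.1 ((e0 j).trans (by rw [e1', mul_zero]))).resolve_left hpc
    refine hg0 (funext fun i => funext fun j => ?_)
    fin_cases i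
    · exact e0' j
    · exact e1' j
  have e2 : ∀ j, g x₀ 1 j = 0 := fun j => by
    have := e0 j
    rw [hp0, Int.cast_zero, zero_mul] at this
    exact (mul_eq_zero.1 this.symm).resolve_left hκ
  have hZg' : ∀ᶠ x in 𝓝[≠] x₀, ∀ i j, Z x i j = g x i j := by
    simpa [hp0] using hZg
  set w : ℂ → ℂ := fun x => g x 0 0 * g x 1 1 - g x 0 1 * g x 1 0 with hw
  have hwa : AnalyticAt ℂ w x₀ := ((hgij 0 0).mul (hgij 1 1)).sub ((hgij 0 1).mul (hgij 1 0))
  have hw0 : w x₀ = 0 := by simp [hw, e2]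
  have hZw : ∀ᶠ x in 𝓝[≠] x₀, (Z x).det = w x := by
    filter_upwards [hZg'] with x hx
    simp only [Matrix.det_fin_two, hx, hw]
  have hwne : ¬ ∀ᶠ x in 𝓝 x₀, w x = 0 := by
    intro h
    obtain ⟨x, hx1, hx2, hx3⟩ := ((h.filter_mono (nhdsWithin_le_nhds (s := {x₀}ᶜ))).and
      (hZw.and hdet)).exists
    exact hx3 (hx2.trans hx1)
  obtain ⟨q, s, hs, hs0, hws⟩ := hwa.exists_eventuallyEq_pow_smul_nonzero_iff.2 hwne
  have hZs : ∀ᶠ x in 𝓝[≠] x₀, (Z x).det = (x - x₀) ^ (q : ℤ) * s x := by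
    filter_upwards [hZw, hws.filter_mono nhdsWithin_le_nhds] with x hx1 hx2
    rw [hx1, hx2, zpow_natCast, smul_eq_mul]
  have e3 := indicial_equation (p := q) (u := s) (f := fun x => (Z x).det)
    (r := fun x => (x - x₀) * ((B x 0 0 + B x 1 1) * s x)) hs
    (hsub.mul (((hB 0 0).add (hB 1 1)).mul hs.continuousAt)) hZs (by
      filter_upwards [hZs, h0, h1, self_mem_nhdsWithin] with x hx1 hx2 hx3 hx4
      have hx0 : x - x₀ ≠ 0 := sub_ne_zero.2 hx4
      have hdd : HasDerivAt (fun x => (Z x).det) ((B x 0 0 + B x 1 1) * (Z x).det) x := by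
        simp only [Matrix.det_fin_two]
        refine (((hx2 0).mul (hx3 1)).sub ((hx2 1).mul (hx3 0))).congr_deriv ?_
        ring
      refine hdd.congr_deriv ?_
      rw [hx1, zpow_sub_one₀ hx0]
      field_simp)
  have hq : q = 0 := by
    rw [sub_self, zero_mul] at e3
    exact_mod_cast (mul_eq_zero.1 e3).resolve_right hs0
  refine hs0 ?_
  have := hws.self_of_nhds
  rw [hw0, hq, pow_zero, one_smul] at this
  exact this.symm

end RegularSingular

/- STATEMENT 10: For the 2×2 system with a₁₁, a₂₂ holomorphic across x₀,
   a₁₂ with a pole of order exactly 2 (leading coefficients γ₋₂ ≠ 0, γ₋₁) and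
   a₂₁ holomorphic with a zero of order ≥ 2 at x₀, the system dW/dx = ρA(x)W has a
   strong regular fundamental solution at x₀ for every ρ ∈ ℂ if and only if
   α₀ = β₀ and γ₋₁ = 0. -/
theorem stmt_10 (x₀ : ℂ) (ρ₀ : ℝ) (hρ₀ : 0 < ρ₀)
    (D : Set ℂ) (hD : D = {x : ℂ | 0 < ‖x - x₀‖ ∧ ‖x - x₀‖ < ρ₀})
    (A : ℂ → Matrix (Fin 2) (Fin 2) ℂ)
    (α β γ μ : ℕ → ℂ) (γm2 γm1 : ℂ) (hγm2 : γm2 ≠ 0)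
    -- a₁₁(x) = α₀ + α₁(x−x₀) + …
    (hA11 : ∀ x ∈ D, HasSum (fun k : ℕ => α k * (x - x₀) ^ k) (A x 0 0))
    -- a₂₂(x) = β₀ + β₁(x−x₀) + …
    (hA22 : ∀ x ∈ D, HasSum (fun k : ℕ => β k * (x - x₀) ^ k) (A x 1 1))
    -- a₁₂(x) = γ₋₂(x−x₀)⁻² + γ₋₁(x−x₀)⁻¹ + γ₀ + …
    (hA12 : ∀ x ∈ D, HasSum (fun k : ℕ => γ k * (x - x₀) ^ k)
      (A x 0 1 - γm2 * ((x - x₀) ^ (-2 : ℤ)) - γm1 * (x - x₀)⁻¹))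
    -- a₂₁(x) = μ₂(x−x₀)² + μ₃(x−x₀)³ + …
    (hA21 : ∀ x ∈ D, HasSum (fun k : ℕ => μ k * (x - x₀) ^ (k + 2)) (A x 1 0)) :
    (∀ ρ : ℂ, ∃ W : ℂ → Matrix (Fin 2) (Fin 2) ℂ,
      -- W solves dW/dx = ρA(x)W on D
      (∀ x ∈ D, ∀ i j, HasDerivAt (fun y => W y i j) ((ρ • A x * W x) i j) x) ∧
      -- W is a fundamental solution
      (∀ x ∈ D, (W x).det ≠ 0) ∧
      -- strong regularity: (x−x₀)^{−m} W(x) extends holomorphically across x₀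
      (∃ (m : ℤ) (V : ℂ → Matrix (Fin 2) (Fin 2) ℂ),
        (∀ i j, DifferentiableOn ℂ (fun x => V x i j) (Metric.ball x₀ ρ₀)) ∧
        ∀ x ∈ D, W x = ((x - x₀) ^ m) • V x)) ↔
    (α 0 = β 0 ∧ γm1 = 0) := by
  subst hD
  have hD : ∀ {x}, x ∈ {x : ℂ | 0 < ‖x - x₀‖ ∧ ‖x - x₀‖ < ρ₀} →
      x - x₀ ≠ 0 ∧ x ∈ Metric.ball x₀ ρ₀ := fun {x} hx =>
    ⟨norm_pos_iff.1 hx.1, by rw [Metric.mem_ball, dist_eq_norm]; exact hx.2⟩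
  have hDev : ∀ᶠ x in 𝓝[≠] x₀, x ∈ {x : ℂ | 0 < ‖x - x₀‖ ∧ ‖x - x₀‖ < ρ₀} := by
    filter_upwards [self_mem_nhdsWithin, mem_nhdsWithin_of_mem_nhds (Metric.ball_mem_nhds x₀ hρ₀)]
      with x hx1 hx2
    exact ⟨norm_pos_iff.2 (sub_ne_zero.2 hx1), by rwa [Metric.mem_ball, dist_eq_norm] at hx2⟩
  obtain ⟨a, ha, ha0, hAa⟩ := exists_holomorphic_of_hasSum (fun x h0 h1 => hA11 x ⟨h0, h1⟩)
  obtain ⟨b, hb, hb0, hAb⟩ := exists_holomorphic_of_hasSum (fun x h0 h1 => hA22 x ⟨h0, h1⟩)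
  obtain ⟨g, hg, -, hAg⟩ := exists_holomorphic_of_hasSum (fun x h0 h1 => hA12 x ⟨h0, h1⟩)
  obtain ⟨h, hh, -, hAh⟩ := exists_holomorphic_of_hasSum (x₀ := x₀) (R := ρ₀) (c := μ)
    (a := fun x => A x 1 0 / (x - x₀) ^ 2) (fun x h0 h1 => by
      refine ((hA21 x ⟨h0, h1⟩).div_const ((x - x₀) ^ 2)).congr_fun fun k => ?_
      have := norm_pos_iff.1 h0
      field_simp
      ring)
  have e11 : ∀ x ∈ {x : ℂ | 0 < ‖x - x₀‖ ∧ ‖x - x₀‖ < ρ₀}, A x 0 0 = a x := fun x hx =>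
    hAa x hx.1 hx.2
  have e22 : ∀ x ∈ {x : ℂ | 0 < ‖x - x₀‖ ∧ ‖x - x₀‖ < ρ₀}, A x 1 1 = b x := fun x hx =>
    hAb x hx.1 hx.2
  have e12 : ∀ x ∈ {x : ℂ | 0 < ‖x - x₀‖ ∧ ‖x - x₀‖ < ρ₀},
      A x 0 1 = γm2 / (x - x₀) ^ 2 + γm1 / (x - x₀) + g x := fun x hx => by
    rw [← hAg x hx.1 hx.2, zpow_neg, div_eq_mul_inv, div_eq_mul_inv]
    norm_cast
    ring
  have e21 : ∀ x ∈ {x : ℂ | 0 < ‖x - x₀‖ ∧ ‖x - x₀‖ < ρ₀}, A x 1 0 = (x - x₀) ^ 2 * h x :=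
    fun x hx => by
      rw [← hAh x hx.1 hx.2]
      have := (hD hx).1
      field_simp
  have hball : Metric.ball x₀ ρ₀ ∈ 𝓝 x₀ := Metric.ball_mem_nhds x₀ hρ₀
  set d : ℂ → ℂ := dslope (fun x => a x - b x) x₀ with hd_def
  have hd : DifferentiableOn ℂ d (Metric.ball x₀ ρ₀) :=
    (Complex.differentiableOn_dslope hball).2 (ha.sub hb)
  have had : ∀ x, a x - b x = (α 0 - β 0) + (x - x₀) * d x := fun x => by
    have := sub_smul_dslope (fun x => a x - b x) x₀ x
    rw [smul_eq_mul, ha0, hb0] at this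
    rw [hd_def, this]
    ring
  -- coefficient matrix of the regularised system satisfied by `(w₁ + ρ γ₋₂ / (x - x₀) w₂, w₂)`
  set B : ℂ → ℂ → Matrix (Fin 2) (Fin 2) ℂ := fun ρ x =>
    !![ρ * a x + ρ ^ 2 * γm2 * ((x - x₀) * h x),
       -ρ ^ 2 * γm2 * d x + ρ * g x - ρ ^ 3 * γm2 ^ 2 * h x;
       ρ * ((x - x₀) ^ 2 * h x),
       ρ * (b x - ρ * γm2 * ((x - x₀) * h x))] with hB_def
  have hB : ∀ ρ i j, DifferentiableOn ℂ (fun x => B ρ x i j) (Metric.ball x₀ ρ₀) := by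
    intro ρ i j
    fin_cases i <;> fin_cases j <;> simp [hB_def] <;> fun_prop
  constructor
  · intro H
    have hκ : ∀ ρ : ℂ, ρ * γm1 - ρ ^ 2 * γm2 * (α 0 - β 0) = 0 := by
      intro ρ
      obtain ⟨W, hW, hWdet, m, V, hV, hWV⟩ := H ρ
      set P : ℂ → Matrix (Fin 2) (Fin 2) ℂ := fun x => !![1, ρ * γm2 / (x - x₀); 0, 1] with hP
      set Q : ℂ → Matrix (Fin 2) (Fin 2) ℂ := fun x => !![x - x₀, ρ * γm2; 0, x - x₀] with hQ
      have hV' : ∀ i j, AnalyticAt ℂ (fun x => V x i j) x₀ := fun i j => (hV i j).analyticAt hball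
      refine residue_eq_zero_of_meromorphic_fundamental (x₀ := x₀) (k := m - 1) (B := B ρ)
        (Z := fun x => P x * W x) (V := fun x => Q x * V x)
        (fun i j => ((hB ρ i j).differentiableAt hball).continuousAt) ?_ ?_ ?_ ?_ ?_
      · intro i j
        fin_cases i <;> simp [hQ, Matrix.mul_apply, Fin.sum_univ_two] <;> fun_prop
      · filter_upwards [hDev] with x hx
        have hx0 := (hD hx).1
        have hPQ : P x = (x - x₀)⁻¹ • Q x := by
          ext i j
          fin_cases i <;> fin_cases j <;> simp [hP, hQ, hx0]
          field_simp
        rw [hWV x hx, zpow_sub_one₀ hx0, hPQ, smul_mul_smul_comm, mul_comm]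
      · filter_upwards [hDev] with x hx
        rw [Matrix.det_mul]
        simpa [hP] using hWdet x hx
      · filter_upwards [hDev] with x hx j
        have hx0 := (hD hx).1
        have hinv : HasDerivAt (fun y => ρ * γm2 / (y - x₀)) (-(ρ * γm2) / (x - x₀) ^ 2) x := by
          refine ((hasDerivAt_const x (ρ * γm2)).div ((hasDerivAt_id x).sub_const x₀)
            hx0).congr_deriv ?_
          simp
        have hZ : (fun y => (P y * W y) 0 j) =
            fun y => W y 0 j + ρ * γm2 / (y - x₀) * W y 1 j := by
          ext y; simp [hP, Matrix.mul_apply, Fin.sum_univ_two]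
        rw [hZ]
        refine ((hW x hx 0 j).add (hinv.mul (hW x hx 1 j))).congr_deriv ?_
        have hab : a x = b x + (α 0 - β 0) + (x - x₀) * d x := by linear_combination had x
        simp only [hP, hB_def, Matrix.mul_apply, Fin.sum_univ_two, Matrix.smul_apply, smul_eq_mul,
          e11 x hx, e12 x hx, e21 x hx, e22 x hx, Matrix.of_apply, Matrix.cons_val_zero,
          Matrix.cons_val_one, Matrix.cons_val', Matrix.cons_val_fin_one, hab]
        field_simp
        ring
      · filter_upwards [hDev] with x hx j
        have hx0 := (hD hx).1
        have hZ : (fun y => (P y * W y) 1 j) = fun y => W y 1 j := by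
          ext y; simp [hP, Matrix.mul_apply, Fin.sum_univ_two]
        rw [hZ]
        refine (hW x hx 1 j).congr_deriv ?_
        simp only [hP, hB_def, Matrix.mul_apply, Fin.sum_univ_two, Matrix.smul_apply, smul_eq_mul,
          e21 x hx, e22 x hx, Matrix.of_apply, Matrix.cons_val_zero,
          Matrix.cons_val_one, Matrix.cons_val', Matrix.cons_val_fin_one]
        field_simp
        ring
    have h1 := hκ 1
    have h2 := hκ (-1)
    have h3 : γm2 * (α 0 - β 0) = 0 := by linear_combination -(h1 + h2) / 2
    exact ⟨sub_eq_zero.1 ((mul_eq_zero.1 h3).resolve_left hγm2), by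
      linear_combination (h1 - h2) / 2⟩
  · rintro ⟨hαβ, hγ⟩ ρ
    obtain ⟨Z, hZ, hZdet⟩ := exists_fundamental_solution (hB ρ)
    set Q : ℂ → Matrix (Fin 2) (Fin 2) ℂ := fun x => !![x - x₀, -(ρ * γm2); 0, x - x₀] with hQ
    have hZd : ∀ i j, DifferentiableOn ℂ (fun x => Z x i j) (Metric.ball x₀ ρ₀) :=
      fun i j x hx => (hZ x hx i j).differentiableAt.differentiableWithinAt
    refine ⟨fun x => (x - x₀) ^ (-1 : ℤ) • (Q x * Z x), fun x hx i j => ?_, fun x hx => ?_,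
      -1, fun x => Q x * Z x, fun i j => ?_, fun x _ => rfl⟩
    · have hx0 := (hD hx).1
      have hxb := (hD hx).2
      have hab : a x = b x + (x - x₀) * d x := by linear_combination had x + hαβ
      have hid := (hasDerivAt_id x).sub_const x₀
      have hinv : HasDerivAt (fun y => (y - x₀)⁻¹) (-1 / (x - x₀) ^ 2) x := hid.inv hx0
      have hQ0 : ∀ y j, (Q y * Z y) 0 j = (y - x₀) * Z y 0 j + -(ρ * γm2) * Z y 1 j := by
        intro y j; simp [hQ, Matrix.mul_apply, Fin.sum_univ_two]
      have hQ1 : ∀ y j, (Q y * Z y) 1 j = (y - x₀) * Z y 1 j := by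
        intro y j; simp [hQ, Matrix.mul_apply, Fin.sum_univ_two]
      have hZ' := fun i => hZ x hxb i j
      have hi : i = 0 ∨ i = 1 := by fin_cases i <;> simp
      simp only [Matrix.smul_apply, smul_eq_mul, zpow_neg_one]
      rcases hi with rfl | rfl
      · simp only [hQ0]
        refine (hinv.mul ((hid.mul (hZ' 0)).add ((hZ' 1).const_mul _))).congr_deriv ?_
        rw [Matrix.mul_apply, Matrix.mul_apply, Matrix.mul_apply, Fin.sum_univ_two,
          Fin.sum_univ_two, Fin.sum_univ_two]
        simp only [Matrix.smul_apply, smul_eq_mul, hQ0, hQ1, hB_def,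
          e11 x hx, e12 x hx, Matrix.of_apply, Matrix.cons_val_zero,
          Matrix.cons_val_one, Matrix.cons_val', Matrix.cons_val_fin_one, hab, hγ, id,
          Pi.add_apply, Pi.mul_apply]
        field_simp
        ring
      · simp only [hQ1]
        refine (hinv.mul (hid.mul (hZ' 1))).congr_deriv ?_
        rw [Matrix.mul_apply, Matrix.mul_apply, Fin.sum_univ_two, Fin.sum_univ_two]
        simp only [Matrix.smul_apply, smul_eq_mul, hQ0, hQ1, hB_def,
          e21 x hx, e22 x hx, Matrix.of_apply, Matrix.cons_val_zero,
          Matrix.cons_val_one, Matrix.cons_val', Matrix.cons_val_fin_one, id, Pi.mul_apply]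
        field_simp
        ring
    · have hx0 := (hD hx).1
      rw [Matrix.det_smul, Matrix.det_mul]
      refine mul_ne_zero (pow_ne_zero _ (zpow_ne_zero _ hx0)) (mul_ne_zero ?_ (hZdet x (hD hx).2))
      simpa [hQ, Matrix.det_fin_two] using hx0
    · fin_cases i <;> simp [hQ, Matrix.mul_apply, Fin.sum_univ_two] <;> fun_prop
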